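/- The minimum distance d of a binary self-dual code of length n satisfies d ≤ 4⌊n/24⌋ + 6 if n ≡ 22 (mod 24), and d ≤ 4⌊n/24⌋ + 4 otherwise. -/

import Mathlib

/-- The dual (with respect to the standard inner product) of a set of
vectors in `F₂ⁿ`. -/
def dualSet {n : ℕ} (C : Set (Fin n → ZMod 2)) : Set (Fin n → ZMod 2) :=
  {y | ∀ x ∈ C, ∑ i, x i * y i = 0}

open Finset Polynomial
open scoped PowerSeries

/-- The nontrivial complex character of `ZMod 2`. -/
noncomputable def signChar (a : ZMod 2) : ℂ := (-1) ^ a.val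

lemma signChar_zero : signChar 0 = 1 := by simp [signChar]

lemma signChar_one : signChar 1 = -1 := by simp [signChar, ZMod.val_one]

lemma signChar_add (a b : ZMod 2) : signChar (a + b) = signChar a * signChar b := by
  obtain rfl | rfl : a = 0 ∨ a = 1 := by revert a; decide
  · simp [signChar_zero]
  obtain rfl | rfl : b = 0 ∨ b = 1 := by revert b; decide
  · simp [signChar_zero]
  · rw [show (1 + 1 : ZMod 2) = 0 from rfl]
    simp [signChar_one, signChar_zero]

lemma signChar_sum {ι : Type*} (s : Finset ι) (f : ι → ZMod 2) :
    signChar (∑ i ∈ s, f i) = ∏ i ∈ s, signChar (f i) := by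
  induction s using Finset.cons_induction with
  | empty => simp [signChar_zero]
  | cons a s ha ih => rw [sum_cons, prod_cons, signChar_add, ih]

section SelfDual

variable {n : ℕ}

lemma pow_hammingNorm (y : ℂ) (v : Fin n → ZMod 2) :
    y ^ hammingNorm v = ∏ i, if v i = 0 then 1 else y := by
  rw [prod_ite]
  simp [hammingNorm]

lemma hammingNorm_le (v : Fin n → ZMod 2) : hammingNorm v ≤ n := by
  simpa using hammingNorm_le_card_fintype (x := v)

/-- The Fourier transform of `v ↦ y ^ wt v`. -/
lemma sum_signChar_mul_pow_hammingNorm (y : ℂ) (t : Fin n → ZMod 2) :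
    ∑ v : Fin n → ZMod 2, signChar (t ⬝ᵥ v) * y ^ hammingNorm v =
      (1 + y) ^ (n - hammingNorm t) * (1 - y) ^ hammingNorm t := by
  have hfac : ∀ v : Fin n → ZMod 2, signChar (t ⬝ᵥ v) * y ^ hammingNorm v =
      ∏ i, (signChar (t i * v i) * if v i = 0 then 1 else y) := fun v => by
    rw [dotProduct, signChar_sum, pow_hammingNorm, prod_mul_distrib]
  have hcoord : ∀ i, ∑ a : ZMod 2, (signChar (t i * a) * if a = 0 then 1 else y) =
      if t i = 0 then 1 + y else 1 - y := fun i => by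
    have h2 : ∀ f : ZMod 2 → ℂ, ∑ a, f a = f 0 + f 1 := fun f => Fin.sum_univ_two f
    rw [h2]
    obtain h | h : t i = 0 ∨ t i = 1 := by generalize t i = a; revert a; decide
    · simp [h, signChar_zero]
    · simp [h, signChar_zero, signChar_one]; ring
  rw [sum_congr rfl fun v _ => hfac v,
    ← Fintype.prod_sum fun i a => signChar (t i * a) * if a = 0 then (1 : ℂ) else y,
    prod_congr rfl fun i _ => hcoord i, prod_ite, prod_const, prod_const]
  have hcard : #{i | t i = 0} = n - hammingNorm t := by
    have h := card_filter_add_card_filter_not (s := (univ : Finset (Fin n))) (fun i => t i = 0)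
    simp only [card_univ, Fintype.card_fin] at h
    have : hammingNorm t = #{i | ¬ t i = 0} := rfl
    omega
  rw [hcard]
  rfl

lemma mem_iff_forall_dotProduct {C : Submodule (ZMod 2) (Fin n → ZMod 2)}
    (hsd : (C : Set (Fin n → ZMod 2)) = dualSet (C : Set (Fin n → ZMod 2)))
    (v : Fin n → ZMod 2) : v ∈ C ↔ ∀ c ∈ C, c ⬝ᵥ v = 0 := by
  rw [← SetLike.mem_coe, hsd]
  rfl

open Classical in
lemma sum_signChar_dotProduct {C : Submodule (ZMod 2) (Fin n → ZMod 2)}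
    (hsd : (C : Set (Fin n → ZMod 2)) = dualSet (C : Set (Fin n → ZMod 2)))
    (v : Fin n → ZMod 2) :
    ∑ c : C, signChar (c ⬝ᵥ v) = if v ∈ C then (Fintype.card C : ℂ) else 0 := by
  split_ifs with hv
  · rw [sum_congr rfl fun c _ => by
      rw [(mem_iff_forall_dotProduct hsd v).1 hv c c.2, signChar_zero]]
    simp
  · rw [mem_iff_forall_dotProduct hsd v] at hv
    push Not at hv
    obtain ⟨c₀, hc₀, hne⟩ := hv
    have hone : c₀ ⬝ᵥ v = 1 := by
      revert hne
      generalize c₀ ⬝ᵥ v = a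
      revert a
      decide
    have h := Equiv.sum_comp (Equiv.addRight (⟨c₀, hc₀⟩ : C))
      fun c : C => signChar ((c : Fin n → ZMod 2) ⬝ᵥ v)
    simp only [Equiv.coe_addRight, Submodule.coe_add, add_dotProduct, signChar_add, hone,
      signChar_one, mul_neg, mul_one, sum_neg_distrib] at h
    linear_combination (-1 / 2 : ℂ) * h

open Classical in
/-- Poisson summation over a coset of a self-dual code. -/
lemma card_mul_sum_signChar_mul_pow {C : Submodule (ZMod 2) (Fin n → ZMod 2)}
    (hsd : (C : Set (Fin n → ZMod 2)) = dualSet (C : Set (Fin n → ZMod 2)))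
    (s : Fin n → ZMod 2) (y : ℂ) :
    (Fintype.card C : ℂ) *
        ∑ c : C, signChar (s ⬝ᵥ c) * y ^ hammingNorm (c : Fin n → ZMod 2) =
      ∑ c : C, (1 + y) ^ (n - hammingNorm (c.1 + s)) * (1 - y) ^ hammingNorm (c.1 + s) := by
  simp_rw [← sum_signChar_mul_pow_hammingNorm]
  simp_rw [add_dotProduct, signChar_add]
  rw [sum_comm]
  have hinner : ∀ v : Fin n → ZMod 2,
      ∑ c : C, signChar (c ⬝ᵥ v) * signChar (s ⬝ᵥ v) * y ^ hammingNorm v =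
        if v ∈ C then (Fintype.card C : ℂ) * (signChar (s ⬝ᵥ v) * y ^ hammingNorm v) else 0 :=
    fun v => by
      simp_rw [mul_assoc, ← sum_mul]
      rw [sum_signChar_dotProduct hsd, ite_mul, zero_mul]
  rw [sum_congr rfl fun v _ => hinner v, ← sum_filter, mul_sum]
  exact (sum_subtype (univ.filter (· ∈ C)) (p := (· ∈ C)) (by simp)
    fun v => (Fintype.card C : ℂ) * (signChar (s ⬝ᵥ v) * y ^ hammingNorm v)).symm

lemma hammingNorm_eq_sum_val (x : Fin n → ZMod 2) : hammingNorm x = ∑ i, (x i).val := by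
  rw [hammingNorm, card_filter]
  refine sum_congr rfl fun i _ => ?_
  generalize x i = a
  revert a
  decide

lemma hammingNorm_add_add (x y : Fin n → ZMod 2) :
    hammingNorm (x + y) + 2 * ∑ i, (x i * y i).val = hammingNorm x + hammingNorm y := by
  simp only [hammingNorm_eq_sum_val, mul_sum, ← sum_add_distrib, Pi.add_apply]
  refine sum_congr rfl fun i _ => ?_
  generalize x i = a
  generalize y i = b
  revert a b
  decide

lemma natCast_sum_val_mul (x y : Fin n → ZMod 2) :
    ((∑ i, (x i * y i).val : ℕ) : ZMod 2) = x ⬝ᵥ y := by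
  simp [dotProduct]

lemma natCast_hammingNorm (x : Fin n → ZMod 2) : (hammingNorm x : ZMod 2) = x ⬝ᵥ x := by
  rw [hammingNorm_eq_sum_val, Nat.cast_sum, dotProduct]
  refine sum_congr rfl fun i _ => ?_
  generalize x i = a
  revert a
  decide

lemma even_hammingNorm {C : Submodule (ZMod 2) (Fin n → ZMod 2)}
    (hsd : (C : Set (Fin n → ZMod 2)) = dualSet (C : Set (Fin n → ZMod 2)))
    {x : Fin n → ZMod 2} (hx : x ∈ C) : Even (hammingNorm x) := by
  rw [← ZMod.natCast_eq_zero_iff_even, natCast_hammingNorm]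
  exact (mem_iff_forall_dotProduct hsd x).1 hx x hx

lemma even_length {C : Submodule (ZMod 2) (Fin n → ZMod 2)}
    (hsd : (C : Set (Fin n → ZMod 2)) = dualSet (C : Set (Fin n → ZMod 2))) : Even n := by
  have hone : (1 : Fin n → ZMod 2) ∈ C := by
    rw [mem_iff_forall_dotProduct hsd]
    intro c hc
    have h := (ZMod.natCast_eq_zero_iff_even).2 (even_hammingNorm hsd hc)
    rw [hammingNorm_eq_sum_val] at h
    simpa [dotProduct] using h
  have h := (mem_iff_forall_dotProduct hsd _).1 hone _ hone
  rw [← ZMod.natCast_eq_zero_iff_even]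
  simpa [dotProduct] using h

/-- A self-dual code has a shadow vector: one whose inner product with each codeword is half the
weight of the codeword. -/
lemma exists_shadow_vector {C : Submodule (ZMod 2) (Fin n → ZMod 2)}
    (hsd : (C : Set (Fin n → ZMod 2)) = dualSet (C : Set (Fin n → ZMod 2))) :
    ∃ s : Fin n → ZMod 2, ∀ c ∈ C, s ⬝ᵥ c = (hammingNorm c / 2 : ℕ) := by
  let halfWeight : C →+ ZMod 2 := AddMonoidHom.mk' (fun c => ((hammingNorm c.1 / 2 : ℕ) : ZMod 2))
    fun a b => by
      obtain ⟨r, hr⟩ := (ZMod.natCast_eq_zero_iff_even).1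
        ((natCast_sum_val_mul a.1 b.1).trans ((mem_iff_forall_dotProduct hsd b.1).1 b.2 a.1 a.2))
      obtain ⟨p, hp⟩ := even_hammingNorm hsd a.2
      obtain ⟨q, hq⟩ := even_hammingNorm hsd b.2
      have h := hammingNorm_add_add a.1 b.1
      rw [Submodule.coe_add, ← Nat.cast_add, ZMod.natCast_eq_natCast_iff']
      omega
  obtain ⟨φ, hφ⟩ := LinearMap.exists_extend (halfWeight.toZModLinearMap 2)
  refine ⟨fun i => φ fun j => if i = j then 1 else 0, fun c hc => ?_⟩
  have h : φ c = (hammingNorm c / 2 : ℕ) := LinearMap.congr_fun hφ ⟨c, hc⟩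
  rw [← h, LinearMap.pi_apply_eq_sum_univ φ c, dotProduct]
  simp [mul_comm]

lemma signChar_natCast (k : ℕ) : signChar k = (-1) ^ k := by
  rw [signChar, ZMod.val_natCast, ← neg_one_pow_eq_pow_mod_two]

open Classical in
/-- The weight enumerator of a self-dual code in terms of its shadow. -/
lemma card_mul_sum_pow_hammingNorm {C : Submodule (ZMod 2) (Fin n → ZMod 2)}
    (hsd : (C : Set (Fin n → ZMod 2)) = dualSet (C : Set (Fin n → ZMod 2)))
    {s : Fin n → ZMod 2} (hs : ∀ c ∈ C, s ⬝ᵥ c = (hammingNorm c / 2 : ℕ)) (y : ℂ) :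
    (Fintype.card C : ℂ) * ∑ c : C, y ^ hammingNorm c.1 =
      ∑ c : C, (1 + Complex.I * y) ^ (n - hammingNorm (c.1 + s)) *
        (1 - Complex.I * y) ^ hammingNorm (c.1 + s) := by
  rw [← card_mul_sum_signChar_mul_pow hsd]
  congr 1
  refine sum_congr rfl fun c _ => ?_
  obtain ⟨k, hk⟩ := even_hammingNorm hsd c.2
  rw [hs c c.2, signChar_natCast, hk, show (k + k) / 2 = k by omega, ← two_mul, mul_pow,
    pow_mul Complex.I, Complex.I_sq, ← mul_assoc, ← mul_pow]
  simp

lemma hammingNorm_add_shadow_mod_four {C : Submodule (ZMod 2) (Fin n → ZMod 2)}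
    (hsd : (C : Set (Fin n → ZMod 2)) = dualSet (C : Set (Fin n → ZMod 2)))
    {s : Fin n → ZMod 2} (hs : ∀ c ∈ C, s ⬝ᵥ c = (hammingNorm c / 2 : ℕ))
    {c : Fin n → ZMod 2} (hc : c ∈ C) : hammingNorm (c + s) % 4 = hammingNorm s % 4 := by
  have h := hammingNorm_add_add s c
  obtain ⟨k, hk⟩ := even_hammingNorm hsd hc
  have hmod := (natCast_sum_val_mul s c).trans (hs c hc)
  rw [ZMod.natCast_eq_natCast_iff'] at hmod
  rw [add_comm c s]
  omega

lemma one_add_I_pow_mul_one_sub_I_pow {M w : ℕ} (h : w ≤ 2 * M) :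
    (1 + Complex.I) ^ (2 * M - w) * (1 - Complex.I) ^ w =
      2 ^ M * Complex.I ^ ((M + 3 * w) % 4) := by
  have h1 : 1 - Complex.I = Complex.I ^ 3 * (1 + Complex.I) := by
    linear_combination (1 - Complex.I - Complex.I ^ 2) * Complex.I_sq
  rw [h1, mul_pow, mul_left_comm, ← pow_add, Nat.sub_add_cancel h, pow_mul (1 + Complex.I),
    show (1 + Complex.I) ^ 2 = 2 * Complex.I by linear_combination Complex.I_sq, mul_pow,
    ← pow_mul, ← Complex.I_pow_eq_pow_mod, pow_add]
  ring

lemma hammingNorm_add_shadow {C : Submodule (ZMod 2) (Fin n → ZMod 2)}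
    (hsd : (C : Set (Fin n → ZMod 2)) = dualSet (C : Set (Fin n → ZMod 2)))
    {s : Fin n → ZMod 2} (hs : ∀ c ∈ C, s ⬝ᵥ c = (hammingNorm c / 2 : ℕ))
    {c : Fin n → ZMod 2} (hc : c ∈ C) : hammingNorm (c + s) % 4 = n / 2 % 4 := by
  classical
  obtain ⟨M, hM⟩ := even_length hsd
  rw [← two_mul] at hM
  have h := card_mul_sum_pow_hammingNorm hsd hs 1
  have hterm : ∀ c : C, (1 + Complex.I) ^ (n - hammingNorm (c.1 + s)) *
      (1 - Complex.I) ^ hammingNorm (c.1 + s) =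
        2 ^ M * Complex.I ^ ((M + 3 * hammingNorm s) % 4) := fun c => by
    have hmod := hammingNorm_add_shadow_mod_four hsd hs c.2
    rw [show n - hammingNorm (c.1 + s) = 2 * M - hammingNorm (c.1 + s) by rw [← hM],
      one_add_I_pow_mul_one_sub_I_pow (by rw [← hM]; exact hammingNorm_le _)]
    congr 2
    omega
  simp only [mul_one, one_pow, hterm, sum_const, card_univ, nsmul_eq_mul] at h
  have hcard : (Fintype.card C : ℂ) ≠ 0 := Nat.cast_ne_zero.2 Fintype.card_ne_zero
  have h' := mul_left_cancel₀ hcard h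
  have hpow : (2 : ℂ) ^ M = ((2 ^ M : ℝ) : ℂ) := by push_cast; rfl
  have hcast : (Fintype.card C : ℂ) = ((Fintype.card C : ℝ) : ℂ) := by push_cast; rfl
  rw [hpow, hcast] at h'
  have hpos : (0 : ℝ) < Fintype.card C := Nat.cast_pos.2 Fintype.card_pos
  have h2pos : (0 : ℝ) < 2 ^ M := by positivity
  have hre := congrArg Complex.re h'
  rw [Complex.ofReal_re, Complex.re_ofReal_mul] at hre
  have hmod := hammingNorm_add_shadow_mod_four hsd hs hc
  have hlt : (M + 3 * hammingNorm s) % 4 < 4 := Nat.mod_lt _ (by norm_num)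
  have key : (M + 3 * hammingNorm s) % 4 = 0 := by
    generalize (M + 3 * hammingNorm s) % 4 = r at hre hlt
    interval_cases r
    · rfl
    · simp at hre
    · rw [Complex.I_sq] at hre
      simp at hre
      linarith
    · rw [Complex.I_pow_three] at hre
      simp at hre
  omega

end SelfDual

namespace Polynomial.Chebyshev

/-- The Chebyshev polynomial of the first kind in the variable `1 + 2 X`. -/
noncomputable def shiftedT (q : ℕ) : ℝ[X] := (T ℝ q).comp (1 + 2 * X)

lemma shiftedT_zero : shiftedT 0 = 1 := by simp [shiftedT]

lemma shiftedT_one : shiftedT 1 = 1 + 2 * X := by simp [shiftedT]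

lemma shiftedT_add_two (q : ℕ) :
    shiftedT (q + 2) = shiftedT (q + 1) + (shiftedT (q + 1) - shiftedT q) +
      4 * (X * shiftedT (q + 1)) := by
  simp only [shiftedT, Nat.cast_add, Nat.cast_one, Nat.cast_ofNat, T_add_two, sub_comp, mul_comp,
    X_comp, ofNat_comp]
  ring

lemma coeff_shiftedT_nonneg_and_le_succ (q : ℕ) : ∀ j, 0 ≤ (shiftedT q).coeff j ∧
    (shiftedT q).coeff j ≤ (shiftedT (q + 1)).coeff j := by
  induction q with
  | zero =>
    intro j
    rw [shiftedT_zero, shiftedT_one, coeff_add, coeff_one, coeff_ofNat_mul, coeff_X]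
    split_ifs <;> norm_num
  | succ q ih =>
    intro j
    have hj := ih j
    refine ⟨hj.1.trans hj.2, ?_⟩
    rw [shiftedT_add_two, coeff_add, coeff_add, coeff_sub, coeff_ofNat_mul]
    have : 0 ≤ (X * shiftedT (q + 1)).coeff j := by
      cases j with
      | zero => simp
      | succ j => rw [coeff_X_mul]; exact (ih j).1.trans (ih j).2
    linarith

lemma coeff_shiftedT_nonneg (q j : ℕ) : 0 ≤ (shiftedT q).coeff j :=
  (coeff_shiftedT_nonneg_and_le_succ q j).1

lemma coeff_shiftedT_pos {q j : ℕ} (h : j ≤ q) : 0 < (shiftedT q).coeff j := by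
  have hmono : Monotone fun q => (shiftedT q).coeff j :=
    monotone_nat_of_le_succ fun q => (coeff_shiftedT_nonneg_and_le_succ q j).2
  refine lt_of_lt_of_le ?_ (hmono h)
  clear h hmono
  induction j with
  | zero => simp [shiftedT_zero]
  | succ j ih =>
    cases j with
    | zero =>
      simp [shiftedT_one, coeff_one]
    | succ j =>
      have h := (coeff_shiftedT_nonneg_and_le_succ j (j + 2)).2
      have h' := coeff_shiftedT_nonneg (j + 1) (j + 2)
      simp only [shiftedT_add_two, coeff_add, coeff_sub, coeff_ofNat_mul, coeff_X_mul]
      linarith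

lemma coeff_shiftedT_eq_zero {q j : ℕ} (h : q < j) : (shiftedT q).coeff j = 0 := by
  refine coeff_eq_zero_of_natDegree_lt (lt_of_le_of_lt ?_ h)
  refine natDegree_comp_le.trans ?_
  have h1 : (1 + 2 * X : ℝ[X]).natDegree ≤ 1 := by compute_degree
  have h2 : (T ℝ q).natDegree ≤ q := by simp [natDegree_T]
  simpa using Nat.mul_le_mul h2 h1

lemma pow_add_pow_eq_two_mul_aeval_shiftedT {a b z : ℂ} (hab : a * b = 1)
    (hz : a + b = 2 + 4 * z) (q : ℕ) : a ^ q + b ^ q = 2 * aeval z (shiftedT q) := by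
  induction q using Nat.twoStepInduction with
  | zero => simp [shiftedT_zero]; norm_num
  | one =>
    rw [shiftedT_one]
    simp only [map_add, map_mul, map_one, aeval_X, map_ofNat, pow_one, hz]
    ring
  | more q h0 h1 =>
    rw [shiftedT_add_two]
    simp only [map_add, map_sub, map_mul, aeval_X, map_ofNat]
    have : a ^ (q + 2) + b ^ (q + 2) =
      (a + b) * (a ^ (q + 1) + b ^ (q + 1)) - a * b * (a ^ q + b ^ q) := by ring
    rw [this, hz, hab, h1, h0]
    ring

lemma aeval_shiftedT_eq_sum {q N : ℕ} (h : q < N) (z : ℂ) :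
    aeval z (shiftedT q) = ∑ j ∈ range N, ((shiftedT q).coeff j : ℂ) * z ^ j := by
  have hdeg : (shiftedT q).natDegree < N :=
    lt_of_le_of_lt (natDegree_le_iff_coeff_eq_zero.2 fun j hj => coeff_shiftedT_eq_zero hj) h
  rw [aeval_eq_sum_range' hdeg]
  simp [Complex.real_smul]

end Polynomial.Chebyshev

open Polynomial.Chebyshev

lemma pow_mul_pow_add_swap_of_le {M w N : ℕ} (hw : w ≤ M) (hmod : w % 4 = M % 4) (hN : M < N)
    {y : ℝ} :
    (1 + Complex.I * y) ^ (2 * M - w) * (1 - Complex.I * y) ^ w +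
        (1 + Complex.I * y) ^ w * (1 - Complex.I * y) ^ (2 * M - w) =
      2 * ∑ j ∈ range N, (((shiftedT ((M - w) / 4)).coeff j * (-16) ^ j *
        ((1 + y ^ 2) ^ (M - 4 * j) * (y ^ 2 * (1 - y ^ 2) ^ 2) ^ j) : ℝ) : ℂ) := by
  obtain ⟨q, rfl⟩ : ∃ q, M = w + 4 * q := ⟨(M - w) / 4, by omega⟩
  rw [show (w + 4 * q - w) / 4 = q by omega]
  set D : ℂ := 1 + y ^ 2 with hD
  have hD0 : D ≠ 0 := by
    have : (1 + y ^ 2 : ℝ) ≠ 0 := by positivity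
    rw [hD]
    exact_mod_cast this
  set u := 1 + Complex.I * y with hu
  set v := 1 - Complex.I * y with hv
  have huv : u * v = D := by
    rw [hu, hv, hD]
    linear_combination (-(y : ℂ) ^ 2) * Complex.I_sq
  set z : ℂ := -16 * (y ^ 2 * (1 - y ^ 2) ^ 2) / D ^ 4 with hz
  have hsum : u ^ 8 + v ^ 8 = 2 * D ^ 4 + 4 * (-16 * (y ^ 2 * (1 - y ^ 2) ^ 2)) := by
    have h2 : u ^ 2 + v ^ 2 = 2 - 2 * (y : ℂ) ^ 2 := by
      rw [hu, hv]
      linear_combination (2 * (y : ℂ) ^ 2) * Complex.I_sq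
    have h4 : u ^ 4 + v ^ 4 = (2 - 2 * (y : ℂ) ^ 2) ^ 2 - 2 * D ^ 2 := by
      rw [← h2, ← huv]; ring
    have h8 : u ^ 8 + v ^ 8 = ((2 - 2 * (y : ℂ) ^ 2) ^ 2 - 2 * D ^ 2) ^ 2 - 2 * D ^ 4 := by
      rw [← h4, ← huv]; ring
    rw [h8, hD]
    ring
  have hcheb := pow_add_pow_eq_two_mul_aeval_shiftedT (a := u ^ 8 / D ^ 4) (b := v ^ 8 / D ^ 4)
    (z := z) (by rw [← huv] at hD0 ⊢; field_simp [left_ne_zero_of_mul hD0, right_ne_zero_of_mul hD0])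
    (by rw [← add_div, hsum, hz]; field_simp) q
  rw [aeval_shiftedT_eq_sum (show q < N by omega), div_pow, div_pow, ← add_div,
    div_eq_iff (by positivity)] at hcheb
  calc u ^ (2 * (w + 4 * q) - w) * v ^ w + u ^ w * v ^ (2 * (w + 4 * q) - w)
      = D ^ w * ((u ^ 8) ^ q + (v ^ 8) ^ q) := by
        rw [show 2 * (w + 4 * q) - w = w + 8 * q by omega, ← huv]
        simp only [pow_add, pow_mul, mul_pow]
        ring
    _ = 2 * ∑ j ∈ range N, D ^ (w + 4 * q) * (((shiftedT q).coeff j : ℂ) * z ^ j) := by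
        rw [hcheb, ← mul_sum, pow_add, pow_mul]
        generalize ∑ j ∈ range N, ((shiftedT q).coeff j : ℂ) * z ^ j = S
        ring
    _ = _ := by
        congr 1
        refine sum_congr rfl fun j _ => ?_
        obtain hj | hj := le_or_gt j q
        · obtain ⟨r, rfl⟩ := Nat.exists_eq_add_of_le hj
          rw [show w + 4 * (j + r) - 4 * j = w + 4 * r by omega, hz]
          push_cast
          rw [← hD, div_pow, show w + 4 * (j + r) = w + 4 * r + 4 * j by ring, pow_add D _ (4 * j),
            pow_mul D 4 j, mul_pow (-16 : ℂ)]
          field_simp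
        · simp [coeff_shiftedT_eq_zero hj]

lemma pow_mul_pow_add_swap {M w N : ℕ} (hw : w ≤ 2 * M) (hmod : w % 4 = M % 4) (hN : M < N)
    (y : ℝ) :
    (1 + Complex.I * y) ^ (2 * M - w) * (1 - Complex.I * y) ^ w +
        (1 + Complex.I * y) ^ w * (1 - Complex.I * y) ^ (2 * M - w) =
      2 * ∑ j ∈ range N, (((shiftedT (Nat.dist M w / 4)).coeff j * (-16) ^ j *
        ((1 + y ^ 2) ^ (M - 4 * j) * (y ^ 2 * (1 - y ^ 2) ^ 2) ^ j) : ℝ) : ℂ) := by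
  obtain h | h := le_total w M
  · rw [Nat.dist_eq_sub_of_le_right h]
    exact pow_mul_pow_add_swap_of_le h hmod hN
  · have h' := pow_mul_pow_add_swap_of_le (w := 2 * M - w) (by omega) (by omega) hN (y := y)
    rw [show 2 * M - (2 * M - w) = w by omega, show M - (2 * M - w) = w - M by omega,
      add_comm] at h'
    rw [Nat.dist_eq_sub_of_le h]
    exact h'

namespace PowerSeries

lemma coeff_derivative_X_mul_pow_mul_pow {g h : ℝ⟦X⟧} (hg : h * g = 1) (i j : ℕ) :
    coeff i (d⁄dX ℝ ((X * h) ^ j) * g ^ (i + 1)) = if j = i + 1 then (i + 1 : ℝ) else 0 := by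
  cases j with
  | zero => simp
  | succ j =>
    have hd : d⁄dX ℝ ((X * h) ^ (j + 1)) =
        ((j + 1 : ℝ)) • ((X * h) ^ j * (h + X * d⁄dX ℝ h)) := by
      rw [Derivation.leibniz_pow, Derivation.leibniz, derivative_X]
      simp only [Nat.add_sub_cancel, smul_eq_mul, nsmul_eq_mul, smul_eq_C_mul]
      push_cast
      simp only [map_add, map_natCast, map_one]
      ring
    rw [hd, smul_mul_assoc, coeff_smul, smul_eq_mul]
    obtain hij | rfl | hij := lt_trichotomy i j
    · rw [if_neg (by omega), mul_pow, mul_assoc, mul_assoc, coeff_X_pow_mul', if_neg (by omega),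
        mul_zero]
    · have hexp : (X * h) ^ i * (h + X * d⁄dX ℝ h) * g ^ (i + 1) =
          X ^ i * (1 + X * (d⁄dX ℝ h * g)) := by
        calc _ = X ^ i * ((h * g) ^ i * (h * g + X * (d⁄dX ℝ h * g))) := by ring
          _ = _ := by rw [hg, one_pow, one_mul]
      rw [if_pos rfl, hexp, coeff_X_pow_mul', if_pos le_rfl]
      simp
    · obtain ⟨r, rfl⟩ := Nat.exists_eq_add_of_lt hij
      have hexp : (X * h) ^ j * (h + X * d⁄dX ℝ h) * g ^ (j + r + 1 + 1) =
          X ^ j * (g ^ (r + 1) + X * (d⁄dX ℝ h * g ^ (r + 2))) := by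
        calc _ = X ^ j * ((h * g) ^ j * (h * g * g ^ (r + 1) +
              X * (d⁄dX ℝ h * g ^ (r + 2)))) := by ring
          _ = _ := by rw [hg, one_pow, one_mul, one_mul]
      have hdg : d⁄dX ℝ g = - (d⁄dX ℝ h * g ^ 2) := by
        have h0 := congrArg (d⁄dX ℝ) hg
        rw [Derivation.leibniz, Derivation.map_one_eq_zero] at h0
        simp only [smul_eq_mul] at h0
        linear_combination g * h0 - d⁄dX ℝ g * hg
      have hdpow : d⁄dX ℝ (g ^ (r + 1)) = - ((r + 1 : ℝ) • (d⁄dX ℝ h * g ^ (r + 2))) := by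
        rw [Derivation.leibniz_pow, hdg]
        simp only [Nat.add_sub_cancel, smul_eq_mul, nsmul_eq_mul, smul_eq_C_mul]
        push_cast
        simp only [map_add, map_natCast, map_one]
        ring
      have hcoeff := congrArg (coeff r) hdpow
      rw [coeff_derivative, map_neg, coeff_smul, smul_eq_mul] at hcoeff
      rw [if_neg (by omega), hexp, coeff_X_pow_mul', if_pos (by omega),
        show j + r + 1 - j = r + 1 by omega, map_add, coeff_succ_X_mul]
      have hr : (r + 1 : ℝ) ≠ 0 := by positivity
      refine mul_eq_zero_of_right _ (mul_left_cancel₀ hr ?_)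
      linear_combination hcoeff

/-- A form of Lagrange inversion. -/
lemma coeff_derivative_sum_mul_pow {g h : ℝ⟦X⟧} (hg : h * g = 1) (c : ℕ → ℝ) {i N : ℕ}
    (hi : i + 1 < N) :
    coeff i (d⁄dX ℝ (∑ j ∈ range N, c j • (X * h) ^ j) * g ^ (i + 1)) = (i + 1) * c (i + 1) := by
  rw [map_sum, sum_mul, map_sum, sum_eq_single (i + 1)]
  · rw [Derivation.map_smul, smul_mul_assoc, coeff_smul, coeff_derivative_X_mul_pow_mul_pow hg,
      if_pos rfl, smul_eq_mul, mul_comm]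
  · intro j _ hj
    rw [Derivation.map_smul, smul_mul_assoc, coeff_smul, coeff_derivative_X_mul_pow_mul_pow hg,
      if_neg hj, smul_zero]
  · intro h
    exact absurd (mem_range.2 hi) h

/-- Extraction of the coefficients in an expansion in Gleason's basis. -/
lemma coeff_of_gleason_expansion {U V : ℝ⟦X⟧} (hU : (1 - X) * U = 1) (hV : (1 + X) * V = 1)
    {M N i e : ℕ} {c : ℕ → ℝ} {K : ℝ} {R : ℝ⟦X⟧} (hc : ∀ j, M < 4 * j → c j = 0)
    (hi : i + 1 < N) (he : 6 * (i + 1) = M + 1 + e)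
    (h : K • (1 + X ^ (i + 2) * R) =
      ∑ j ∈ range N, c j • ((1 + X) ^ (M - 4 * j) * (X * (1 - X) ^ 2) ^ j)) :
    (i + 1) * c (i + 1) = - (M * K * coeff i ((1 + X) ^ e * (U * V) ^ (2 * (i + 1)))) := by
  have hg : ((1 - X) ^ 2 * V ^ 4) * ((1 + X) ^ 4 * U ^ 2) = 1 := by
    calc _ = ((1 - X) * U) ^ 2 * ((1 + X) * V) ^ 4 := by ring
      _ = 1 := by rw [hU, hV]; norm_num
  have hF : ∑ j ∈ range N, c j • (X * ((1 - X) ^ 2 * V ^ 4)) ^ j =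
      K • (V ^ M + X ^ (i + 2) * (R * V ^ M)) := by
    have hR : K • (V ^ M + X ^ (i + 2) * (R * V ^ M)) = K • (1 + X ^ (i + 2) * R) * V ^ M := by
      rw [smul_mul_assoc]; congr 1; ring
    rw [hR, h, sum_mul]
    refine sum_congr rfl fun j _ => ?_
    symm
    obtain hj | hj := lt_or_ge M (4 * j)
    · simp [hc j hj]
    · rw [smul_mul_assoc]
      congr 1
      obtain ⟨r, rfl⟩ := Nat.exists_eq_add_of_le hj
      rw [Nat.add_sub_cancel_left]
      calc (1 + X) ^ r * (X * (1 - X) ^ 2) ^ j * V ^ (4 * j + r)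
          = ((1 + X) * V) ^ r * (X * ((1 - X) ^ 2 * V ^ 4)) ^ j := by
            generalize 1 - (X : ℝ⟦X⟧) = Q
            generalize 1 + (X : ℝ⟦X⟧) = P
            ring
        _ = (X * ((1 - X) ^ 2 * V ^ 4)) ^ j := by rw [hV, one_pow, one_mul]
  have hdV : d⁄dX ℝ V = - V ^ 2 := by
    have h0 := congrArg (d⁄dX ℝ) hV
    rw [Derivation.leibniz, Derivation.map_one_eq_zero, map_add, Derivation.map_one_eq_zero,
      derivative_X] at h0
    simp only [smul_eq_mul] at h0
    linear_combination V * h0 - d⁄dX ℝ V * hV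
  have hdVM : d⁄dX ℝ (V ^ M) = - ((M : ℝ) • V ^ (M + 1)) := by
    rw [Derivation.leibniz_pow, hdV]
    cases M with
    | zero => simp
    | succ M =>
      simp only [Nat.add_sub_cancel, smul_eq_mul, nsmul_eq_mul, smul_eq_C_mul, map_natCast]
      ring
  have hdX : d⁄dX ℝ (X ^ (i + 2) * (R * V ^ M)) =
      X ^ (i + 1) * (((i + 2 : ℕ) : ℝ⟦X⟧) * (R * V ^ M) + X * d⁄dX ℝ (R * V ^ M)) := by
    rw [Derivation.leibniz, Derivation.leibniz_pow, derivative_X]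
    simp only [smul_eq_mul, nsmul_eq_mul, show i + 2 - 1 = i + 1 from rfl]
    ring
  have hVP : V ^ (M + 1) * ((1 + X) ^ 4 * U ^ 2) ^ (i + 1) =
      (1 + X) ^ e * (U * V) ^ (2 * (i + 1)) := by
    symm
    calc (1 + X) ^ e * (U * V) ^ (2 * (i + 1))
        = (1 + X) ^ e * (U * V) ^ (2 * (i + 1)) * ((1 + X) * V) ^ (4 * (i + 1)) := by
          rw [hV, one_pow, mul_one]
      _ = (1 + X) ^ e * U ^ (2 * (i + 1)) * (1 + X) ^ (4 * (i + 1)) * V ^ (6 * (i + 1)) := by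
          rw [mul_pow, mul_pow]; ring
      _ = ((1 + X) * V) ^ e * (V ^ (M + 1) * ((1 + X) ^ 4 * U ^ 2) ^ (i + 1)) := by
          rw [he, pow_add V (M + 1)]
          generalize 1 + (X : ℝ⟦X⟧) = P
          ring
      _ = _ := by rw [hV, one_pow, one_mul]
  rw [← coeff_derivative_sum_mul_pow hg c hi, hF, Derivation.map_smul, map_add, hdVM, hdX,
    smul_mul_assoc, coeff_smul, add_mul, map_add, mul_assoc, coeff_X_pow_mul', if_neg (by omega),
    neg_mul, smul_mul_assoc, map_neg, coeff_smul, hVP]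
  simp only [smul_eq_mul]
  ring

lemma coeff_of_one_sub_X_sq_mul {f F : ℝ⟦X⟧} (h : (1 - X ^ 2) * F = f)
    (hf : ∀ k, 0 ≤ coeff k f) (hf0 : 0 < coeff 0 f) (k : ℕ) :
    0 ≤ coeff k F ∧ (Even k → 0 < coeff k F) := by
  induction k using Nat.strong_induction_on with
  | _ k ih =>
    have hk : coeff k F = coeff k f + if 2 ≤ k then coeff (k - 2) F else 0 := by
      rw [← coeff_X_pow_mul', ← map_add, ← h]
      congr 1
      ring
    have hfk := hf k
    obtain h2 | h2 := le_or_gt 2 k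
    · rw [if_pos h2] at hk
      have hprev := ih (k - 2) (by omega)
      refine ⟨by linarith, fun he => ?_⟩
      have := hprev.2 ((Nat.even_sub h2).2 (by simp [he]))
      linarith
    · rw [if_neg (by omega), add_zero] at hk
      refine ⟨hk ▸ hfk, fun he => ?_⟩
      obtain rfl : k = 0 := by
        obtain ⟨r, rfl⟩ := he
        omega
      rwa [hk]

lemma coeff_pow_of_one_sub_X_sq_mul {E : ℝ⟦X⟧} (hE : (1 - X ^ 2) * E = 1) (m k : ℕ) :
    0 ≤ coeff k (E ^ (m + 1)) ∧ (Even k → 0 < coeff k (E ^ (m + 1))) := by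
  induction m generalizing k with
  | zero =>
    refine coeff_of_one_sub_X_sq_mul (f := 1) (by simpa using hE) (fun j => ?_) (by simp) k
    rw [coeff_one]
    split_ifs <;> norm_num
  | succ m ih =>
    refine coeff_of_one_sub_X_sq_mul (f := E ^ (m + 1)) ?_ (fun j => (ih j).1)
      ((ih 0).2 (by simp)) k
    rw [pow_succ' E (m + 1), ← mul_assoc, hE, one_mul]

lemma coeff_one_add_X_pow_mul {F : ℝ⟦X⟧}
    (hF : ∀ k, 0 ≤ coeff k F ∧ (Even k → 0 < coeff k F)) (e k : ℕ) :
    0 ≤ coeff k ((1 + X) ^ e * F) ∧ (Even k ∨ 0 < e → 0 < coeff k ((1 + X) ^ e * F)) := by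
  induction e generalizing k with
  | zero => simpa using hF k
  | succ e ih =>
    rw [pow_succ', mul_assoc, add_mul, one_mul, map_add]
    cases k with
    | zero =>
      rw [coeff_zero_X_mul, add_zero]
      exact ⟨(ih 0).1, fun _ => (ih 0).2 (by simp)⟩
    | succ k =>
      rw [coeff_succ_X_mul]
      have h1 := ih (k + 1)
      have h2 := ih k
      refine ⟨add_nonneg h1.1 h2.1, fun _ => ?_⟩
      obtain hk | hk := Nat.even_or_odd k
      · exact add_pos_of_nonneg_of_pos h1.1 (h2.2 (Or.inl hk))
      · exact add_pos_of_pos_of_nonneg (h1.2 (Or.inl hk.add_one)) h2.1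

end PowerSeries

section SelfDual

variable {n : ℕ}

/-- The coefficients of the weight enumerator of a self-dual code in Gleason's basis, in terms of
the shadow. -/
noncomputable def gleasonCoeff (C : Submodule (ZMod 2) (Fin n → ZMod 2)) (s : Fin n → ZMod 2)
    (j : ℕ) : ℝ :=
  (∑ᶠ c : C, (shiftedT (Nat.dist (n / 2) (hammingNorm (c.1 + s)) / 4)).coeff j) * (-16) ^ j

open Classical in
lemma gleason_expansion {C : Submodule (ZMod 2) (Fin n → ZMod 2)}
    (hsd : (C : Set (Fin n → ZMod 2)) = dualSet (C : Set (Fin n → ZMod 2)))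
    {s : Fin n → ZMod 2} (hs : ∀ c ∈ C, s ⬝ᵥ c = (hammingNorm c / 2 : ℕ)) {N : ℕ}
    (hN : n / 2 < N) :
    (Fintype.card C : ℝ) • ∑ c : C, (X : ℝ[X]) ^ (hammingNorm c.1 / 2) =
      ∑ j ∈ range N, gleasonCoeff C s j •
        ((1 + X) ^ (n / 2 - 4 * j) * (X * (1 - X) ^ 2) ^ j) := by
  refine eq_of_infinite_eval_eq _ _ ((Set.Ici_infinite (0 : ℝ)).mono fun Y hY => ?_)
  obtain ⟨y, rfl⟩ : ∃ y : ℝ, Y = y ^ 2 := ⟨√Y, (Real.sq_sqrt hY).symm⟩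
  obtain ⟨M, hM⟩ := even_length hsd
  rw [← two_mul] at hM
  have hM2 : n / 2 = M := by omega
  have hpos := card_mul_sum_pow_hammingNorm hsd hs y
  have hneg := card_mul_sum_pow_hammingNorm hsd hs (-y)
  have heven : ∀ c : C, (-y : ℂ) ^ hammingNorm c.1 = y ^ hammingNorm c.1 :=
    fun c => (even_hammingNorm hsd c.2).neg_pow _
  simp only [heven] at hneg
  have hsum : (Fintype.card C : ℂ) * ∑ c : C, (y : ℂ) ^ hammingNorm c.1 =
      ∑ c : C, ∑ j ∈ range N,
        (((shiftedT (Nat.dist M (hammingNorm (c.1 + s)) / 4)).coeff j * (-16) ^ j *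
          ((1 + y ^ 2) ^ (M - 4 * j) * (y ^ 2 * (1 - y ^ 2) ^ 2) ^ j) : ℝ) : ℂ) := by
    refine mul_left_cancel₀ (two_ne_zero (α := ℂ)) ?_
    rw [two_mul]
    nth_rewrite 1 [hpos]
    rw [hneg, ← sum_add_distrib, mul_sum]
    refine sum_congr rfl fun c _ => ?_
    have hw := hammingNorm_le (c.1 + s)
    have hmod := hammingNorm_add_shadow hsd hs c.2
    rw [← pow_mul_pow_add_swap (by omega) (by omega) (by omega), ← hM]
    ring
  simp only [← Complex.ofReal_pow, ← Complex.ofReal_sum, ← Complex.ofReal_natCast,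
    ← Complex.ofReal_mul, Complex.ofReal_inj] at hsum
  have hhalf : ∀ c : C, (y ^ 2) ^ (hammingNorm c.1 / 2) = y ^ hammingNorm c.1 := fun c => by
    rw [← pow_mul, Nat.mul_div_cancel' (even_hammingNorm hsd c.2).two_dvd]
  simp only [Set.mem_ofPred_eq, eval_smul, eval_finsetSum, eval_pow, eval_mul, eval_add, eval_sub,
    eval_X, eval_one, smul_eq_mul, hhalf, hM2, gleasonCoeff, finsum_eq_sum_of_fintype]
  rw [hsum, sum_comm]
  refine sum_congr rfl fun j _ => ?_
  rw [sum_mul, sum_mul]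

lemma gleasonCoeff_eq_zero (C : Submodule (ZMod 2) (Fin n → ZMod 2)) (s : Fin n → ZMod 2) {j : ℕ}
    (hn : Even n) (hj : n / 2 < 4 * j) : gleasonCoeff C s j = 0 := by
  classical
  rw [gleasonCoeff, finsum_eq_sum_of_fintype, sum_eq_zero, zero_mul]
  intro c _
  have hw := hammingNorm_le (c.1 + s)
  refine coeff_shiftedT_eq_zero ?_
  rw [Nat.dist]
  obtain ⟨k, hk⟩ := hn
  omega

open Classical in
lemma mul_gleasonCoeff_eq {C : Submodule (ZMod 2) (Fin n → ZMod 2)}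
    (hsd : (C : Set (Fin n → ZMod 2)) = dualSet (C : Set (Fin n → ZMod 2)))
    {s : Fin n → ZMod 2} (hs : ∀ c ∈ C, s ⬝ᵥ c = (hammingNorm c / 2 : ℕ)) {i e : ℕ}
    (he : 6 * (i + 1) = n / 2 + 1 + e) (hmin : ∀ x ∈ C, x ≠ 0 → 2 * (i + 1) < hammingNorm x) :
    ∃ p : ℝ, 0 ≤ p ∧ (0 < e → 0 < p) ∧
      (i + 1) * gleasonCoeff C s (i + 1) = - ((n / 2 : ℕ) * Fintype.card C * p) := by
  have hU : (1 - PowerSeries.X) * (1 - PowerSeries.X : ℝ⟦X⟧)⁻¹ = 1 :=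
    PowerSeries.mul_inv_cancel _ (by simp)
  have hV : (1 + PowerSeries.X) * (1 + PowerSeries.X : ℝ⟦X⟧)⁻¹ = 1 :=
    PowerSeries.mul_inv_cancel _ (by simp)
  set U := (1 - PowerSeries.X : ℝ⟦X⟧)⁻¹
  set V := (1 + PowerSeries.X : ℝ⟦X⟧)⁻¹
  have hexp := congrArg (coeToPowerSeries.algHom (R := ℝ) ℝ)
    (gleason_expansion hsd hs (N := n / 2 + i + 2) (by omega))
  have hsplit : ∑ c : C, (X : ℝ[X]) ^ (hammingNorm c.1 / 2) =
      1 + X ^ (i + 2) * ∑ c ∈ univ.erase (0 : C), X ^ (hammingNorm c.1 / 2 - (i + 2)) := by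
    rw [← add_sum_erase _ _ (mem_univ (0 : C)), mul_sum]
    congr 1
    · simp
    · refine sum_congr rfl fun c hc => ?_
      have hc0 : c.1 ≠ 0 := fun h => (mem_erase.1 hc).1 (Subtype.ext h)
      have hlt := hmin c c.2 hc0
      obtain ⟨k, hk⟩ := even_hammingNorm hsd c.2
      rw [← pow_add, Nat.add_sub_cancel' (by omega)]
  rw [hsplit] at hexp
  simp only [map_smul, map_sum, map_add, map_mul, map_pow, map_sub, map_one,
    coeToPowerSeries.algHom_apply, Algebra.algebraMap_self, coe_X, PowerSeries.map_id] at hexp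
  have hcoeff := PowerSeries.coeff_of_gleason_expansion hU hV
    (fun j hj => gleasonCoeff_eq_zero C s (even_length hsd) hj) (by omega) he hexp
  have hE : (1 - PowerSeries.X ^ 2) * (U * V) = 1 := by
    linear_combination (1 + PowerSeries.X) * V * hU + hV
  have hpos := PowerSeries.coeff_one_add_X_pow_mul
    (PowerSeries.coeff_pow_of_one_sub_X_sq_mul hE (2 * i + 1)) e i
  exact ⟨_, hpos.1, fun h => hpos.2 (Or.inr h), hcoeff⟩

end SelfDual

/-- Rains' bound: the minimum distance `d` of a binary self-dual code of
length `n` satisfies `d ≤ 4⌊n/24⌋ + 6` if `n ≡ 22 (mod 24)` and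
`d ≤ 4⌊n/24⌋ + 4` otherwise. -/
theorem rains_bound {n : ℕ} (C : Submodule (ZMod 2) (Fin n → ZMod 2))
    (hsd : (C : Set (Fin n → ZMod 2)) = dualSet (C : Set (Fin n → ZMod 2)))
    (d : ℕ)
    (hmin : ∀ x ∈ C, x ≠ 0 → d ≤ hammingNorm x)
    (hach : ∃ x ∈ C, x ≠ 0 ∧ hammingNorm x = d) :
    (n % 24 = 22 → d ≤ 4 * (n / 24) + 6) ∧
    (n % 24 ≠ 22 → d ≤ 4 * (n / 24) + 4) := by
  classical
  obtain ⟨s, hs⟩ := exists_shadow_vector hsd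
  obtain ⟨k, hk⟩ := even_length hsd
  set m := n / 24 with hm
  have hn : n ≠ 0 := by
    rintro rfl
    obtain ⟨x, -, hx, -⟩ := hach
    exact hx (Subsingleton.elim _ _)
  have hM : (0 : ℝ) < (n / 2 : ℕ) := Nat.cast_pos.2 (by omega)
  have hcard : (0 : ℝ) < Fintype.card C := Nat.cast_pos.2 Fintype.card_pos
  let σ : ℕ → ℝ := fun j =>
    ∑ c : C, (shiftedT (Nat.dist (n / 2) (hammingNorm (c.1 + s)) / 4)).coeff j
  have hσ : ∀ j, gleasonCoeff C s j = σ j * (-16) ^ j := fun j => by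
    rw [gleasonCoeff, finsum_eq_sum_of_fintype]
  have hσ0 : 0 ≤ σ (2 * m + 2) := sum_nonneg fun c _ => coeff_shiftedT_nonneg _ _
  have hpow : (0 : ℝ) < (-16) ^ (2 * m + 2) := Even.pow_pos ⟨m + 1, by ring⟩ (by norm_num)
  constructor
  · intro hn22
    by_contra! hd
    obtain ⟨p, hp, -, hpc⟩ := mul_gleasonCoeff_eq hsd hs (i := 2 * m + 1) (e := 0) (by omega)
      fun x hx hx0 => by have := hmin x hx hx0; omega
    obtain ⟨r, -, hr, hrc⟩ := mul_gleasonCoeff_eq hsd hs (i := 2 * m + 2) (e := 6) (by omega)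
      fun x hx hx0 => by have := hmin x hx hx0; omega
    rw [hσ] at hpc hrc
    have hσ00 : σ (2 * m + 2) = 0 := by
      refine le_antisymm ?_ hσ0
      by_contra! hlt
      have h1 : 0 < ((2 * m + 1 : ℕ) + 1 : ℝ) * (σ (2 * m + 2) * (-16) ^ (2 * m + 2)) := by
        positivity
      have h2 : 0 ≤ ((n / 2 : ℕ) : ℝ) * Fintype.card C * p := by positivity
      linarith
    have hσ1 : σ (2 * m + 2 + 1) = 0 := by
      refine sum_eq_zero fun c hc => coeff_shiftedT_eq_zero ?_
      by_contra! hle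
      have hzero := (sum_eq_zero_iff_of_nonneg fun c _ => coeff_shiftedT_nonneg _ _).1 hσ00 c hc
      exact (coeff_shiftedT_pos (by omega)).ne' hzero
    rw [hσ1, zero_mul, mul_zero] at hrc
    have h2 : 0 < ((n / 2 : ℕ) : ℝ) * Fintype.card C * r :=
      mul_pos (mul_pos hM hcard) (hr (by norm_num))
    linarith
  · intro hn22
    by_contra! hd
    obtain ⟨p, -, hp, hpc⟩ := mul_gleasonCoeff_eq hsd hs (i := 2 * m + 1) (e := 11 - n / 2 % 12)
      (by omega) fun x hx hx0 => by have := hmin x hx hx0; omega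
    rw [hσ] at hpc
    have h1 : 0 ≤ ((2 * m + 1 : ℕ) + 1 : ℝ) * (σ (2 * m + 2) * (-16) ^ (2 * m + 2)) := by
      positivity
    have h2 : 0 < ((n / 2 : ℕ) : ℝ) * Fintype.card C * p :=
      mul_pos (mul_pos hM hcard) (hp (by omega))
    linarith
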